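/- Let (V, S) be a quantum vertex algebra and set R(x) = S(x)σ: V⊗V → V⊗V⊗ℂ((x)), where σ is the flip on V⊗V. Then R(x) is an invertible twisting operator for the ordered pair (V,V). -/

import Mathlib

open scoped TensorProduct BigOperators

noncomputable section

/-- Integer binomial coefficient `C(n, k)` for `n : ℤ`, `k : ℕ`. -/
def zchoose (n : ℤ) (k : ℕ) : ℤ :=
  if 0 ≤ n then ((n.toNat).choose k : ℤ)
  else (-1) ^ k * ((((k : ℤ) - n - 1).toNat).choose k)

section Series

variable {V : Type*} [AddCommGroup V] [Module ℂ V]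

/-- `a` is (the coefficient family of) an element of `V((x))`. -/
def IsLaurent (a : ℤ → V) : Prop := ∃ N : ℤ, ∀ n : ℤ, n < N → a n = 0

/-- `a` is an element of `V[[x]]`. -/
def IsPowerSeries (a : ℤ → V) : Prop := ∀ n : ℤ, n < 0 → a n = 0

/-- `A` is an element of `V((x₁, x₂))` (first index: exponent of `x₁`). -/
def IsLaurent2 (A : ℤ → ℤ → V) : Prop :=
  ∃ N : ℤ, ∀ m n : ℤ, (m < N ∨ n < N) → A m n = 0

/-- `a` is an element of `V ⊗ ℂ((x)) ⊆ V((x))`: truncated below, with coefficients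
lying in a finitely generated (i.e. finite dimensional) subspace. -/
def IsTensorLaurent (a : ℤ → V) : Prop :=
  IsLaurent a ∧ ∃ F : Submodule ℂ V, F.FG ∧ ∀ n, a n ∈ F

/-- Multiply the double series `A(x₁,x₂)` by `(x₁+x₂)^k`. -/
def mulAddPow (k : ℕ) (A : ℤ → ℤ → V) : ℤ → ℤ → V := fun a b =>
  ∑ j ∈ Finset.range (k + 1), ((k.choose j : ℕ) : ℂ) • A (a - (k : ℤ) + j) (b - j)

/-- Multiply the double series `A(x₁,x₂)` by `(x₁-x₂)^k`. -/
def mulSubPow (k : ℕ) (A : ℤ → ℤ → V) : ℤ → ℤ → V := fun a b =>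
  ∑ j ∈ Finset.range (k + 1),
    ((-1 : ℂ) ^ j * ((k.choose j : ℕ) : ℂ)) • A (a - (k : ℤ) + j) (b - j)

/-- Multiply the double series `A(x₁,x₂)` by `(x₂-x₁)^k`. -/
def mulSubPow' (k : ℕ) (A : ℤ → ℤ → V) : ℤ → ℤ → V := fun a b =>
  ∑ j ∈ Finset.range (k + 1),
    ((-1 : ℂ) ^ j * ((k.choose j : ℕ) : ℂ)) • A (a - j) (b - (k : ℤ) + j)

/-- Substitute `x₁ = x₀ + x₂` in `A(x₁,x₂)`, expanding in nonnegative powers of `x₂`.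
The result is indexed by (exponent of `x₀`, exponent of `x₂`). -/
def substAdd02 (A : ℤ → ℤ → V) : ℤ → ℤ → V := fun a b =>
  ∑ᶠ i : ℕ, ((zchoose (a + i) i : ℤ) : ℂ) • A (a + i) (b - i)

/-- Substitute `x₁ = x₂ + x₀` in `A(x₁,x₂)`, expanding in nonnegative powers of `x₀`.
The result is indexed by (exponent of `x₀`, exponent of `x₂`). -/
def substAdd20 (A : ℤ → ℤ → V) : ℤ → ℤ → V := fun a b =>
  if 0 ≤ a then ∑ᶠ m : ℤ, ((zchoose m a.toNat : ℤ) : ℂ) • A m (b - m + a) else 0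

/-- Multiply the double series `A(x₁,x₂)` by `f(x₂ - x₁)`, expanded in nonnegative
powers of `x₁`. -/
def scalarMulSub (f : ℤ → ℂ) (A : ℤ → ℤ → V) : ℤ → ℤ → V := fun m n =>
  ∑ᶠ (i : ℕ) (p : ℤ),
    ((-1 : ℂ) ^ i * ((zchoose p i : ℤ) : ℂ) * f p) • A (m - i) (n - p + i)

/-- Multiply a double series by a polynomial in two variables. -/
def polyMul2 (p : MvPolynomial (Fin 2) ℂ) (A : ℤ → ℤ → V) : ℤ → ℤ → V := fun m n =>
  ∑ d ∈ p.support, MvPolynomial.coeff d p • A (m - (d 0 : ℤ)) (n - (d 1 : ℤ))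

/-- The relation `A ∼ B`: `p·A = p·B` for some nonzero polynomial `p(x₁,x₂)`. -/
def SimEq2 (A B : ℤ → ℤ → V) : Prop :=
  ∃ p : MvPolynomial (Fin 2) ℂ, p ≠ 0 ∧ ∀ m n : ℤ, polyMul2 p A m n = polyMul2 p B m n

/-- `a` is an element of the iterated Laurent series space `V((x₁))⋯((x_n))`. -/
def IsIterLaurent : (n : ℕ) → ((Fin n → ℤ) → V) → Prop
  | 0, _ => True
  | n + 1, a =>
      (∃ N : ℤ, ∀ k : Fin (n + 1) → ℤ, k (Fin.last n) < N → a k = 0) ∧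
      ∀ m : ℤ, IsIterLaurent n fun k => a (Fin.snoc k m)

end Series

/-- A nonlocal vertex algebra over `ℂ`, with `Y u v n` the coefficient of `x^n`
in `Y(u,x)v` (so `u_m v = Y u v (-m-1)`). -/
structure NLVA (V : Type*) [AddCommGroup V] [Module ℂ V] where
  Y : V →ₗ[ℂ] V →ₗ[ℂ] (ℤ → V)
  one : V
  trunc : ∀ u v : V, IsLaurent (Y u v)
  vacuum_left : ∀ (v : V) (n : ℤ), Y one v n = if n = 0 then v else 0
  creation_reg : ∀ v : V, IsPowerSeries (Y v one)
  creation_zero : ∀ v : V, Y v one 0 = v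
  weak_assoc : ∀ u v w : V, ∃ k : ℕ, ∀ a b : ℤ,
    mulAddPow k (substAdd02 fun m n => Y u (Y v w n) m) a b
      = mulAddPow k (fun a' b' => Y (Y u v a') w b') a b

namespace NLVA

variable {U V K : Type*} [AddCommGroup U] [Module ℂ U] [AddCommGroup V] [Module ℂ V]
  [AddCommGroup K] [Module ℂ K]

/-- The coefficient `Y(·)_n(·)` as a bilinear map. -/
def Yc (𝒱 : NLVA V) (n : ℤ) : V →ₗ[ℂ] V →ₗ[ℂ] V :=
  𝒱.Y.compr₂ (LinearMap.proj n)

/-- The operator `D(v) = v_{-2}𝟙`, i.e. the coefficient of `x^1` in `Y(v,x)𝟙`. -/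
def D (𝒱 : NLVA V) : V →ₗ[ℂ] V :=
  (LinearMap.proj (1 : ℤ)).comp (𝒱.Y.flip 𝒱.one)

/-- Homomorphisms of nonlocal vertex algebras. -/
def IsHom (𝒰 : NLVA U) (𝒱 : NLVA V) (f : U →ₗ[ℂ] V) : Prop :=
  f 𝒰.one = 𝒱.one ∧ ∀ (a b : U) (n : ℤ), f (𝒰.Y a b n) = 𝒱.Y (f a) (f b) n

/-- `𝒦` is generated, as a nonlocal vertex algebra, by the subset `S`. -/
def IsGeneratedBy (𝒦 : NLVA K) (S : Set K) : Prop :=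
  ∀ P : Submodule ℂ K, 𝒦.one ∈ P →
    (∀ a ∈ P, ∀ b ∈ P, ∀ n : ℤ, 𝒦.Y a b n ∈ P) → S ⊆ P → P = ⊤

/-- `𝒰` is irreducible as a module over itself. -/
def SelfIrreducible (𝒰 : NLVA U) : Prop :=
  Nontrivial U ∧
    ∀ P : Submodule ℂ U, (∀ u : U, ∀ p ∈ P, ∀ n : ℤ, 𝒰.Y u p n ∈ P) → P = ⊥ ∨ P = ⊤

/-- The coefficients of the product `Y(v₁,x₁)⋯Y(v_n,x_n)𝟙`. -/
def prodY (𝒱 : NLVA V) : (n : ℕ) → (Fin n → V) → (Fin n → ℤ) → V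
  | 0, _, _ => 𝒱.one
  | n + 1, v, k => 𝒱.Y (v 0) (prodY 𝒱 n (fun i => v i.succ) fun i => k i.succ) (k 0)

/-- Non-degeneracy in the sense of Etingof–Kazhdan: the maps
`Z_n : V^{⊗n} ⊗ ℂ((x₁))⋯((x_n)) → V((x₁))⋯((x_n))` are injective. -/
def NonDegenerate (𝒱 : NLVA V) : Prop :=
  ∀ n : ℕ, 0 < n → ∀ (r : ℕ) (v : Fin r → Fin n → V) (f : Fin r → (Fin n → ℤ) → ℂ),
    (∀ j, IsIterLaurent n (f j)) →
    LinearIndependent ℂ (fun j : Fin r => PiTensorProduct.tprod ℂ (v j)) →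
    (∀ K' : Fin n → ℤ,
      (∑ j : Fin r, ∑ᶠ L : Fin n → ℤ,
        f j L • 𝒱.prodY n (v j) fun i => K' i - L i) = 0) →
    ∀ j, f j = 0

end NLVA

/-- Countable dimension over `ℂ`. -/
def CountableDim (U : Type*) [AddCommGroup U] [Module ℂ U] : Prop :=
  ∃ s : Set U, s.Countable ∧ Submodule.span ℂ s = ⊤

/-- `𝒱` satisfies `𝒮`-locality, i.e. is a weak quantum vertex algebra. -/
def SLocal {V : Type*} [AddCommGroup V] [Module ℂ V] (𝒱 : NLVA V) : Prop :=
  ∀ u v : V, ∃ (r : ℕ) (uu vv : Fin r → V) (f : Fin r → ℤ → ℂ) (k : ℕ),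
    (∀ i, IsLaurent (f i)) ∧ ∀ (w : V) (m n : ℤ),
      mulSubPow k (fun a b => 𝒱.Y u (𝒱.Y v w b) a) m n
        = mulSubPow k (fun a b => ∑ i, scalarMulSub (f i)
            (fun a' b' => 𝒱.Y (vv i) (𝒱.Y (uu i) w a') b') a b) m n

/-- A module for a nonlocal vertex algebra. -/
structure NLVAModule {V : Type*} [AddCommGroup V] [Module ℂ V] (𝒱 : NLVA V)
    (W : Type*) [AddCommGroup W] [Module ℂ W] where
  Yw : V →ₗ[ℂ] W →ₗ[ℂ] (ℤ → W)
  trunc : ∀ (v : V) (w : W), IsLaurent (Yw v w)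
  vacuum : ∀ (w : W) (n : ℤ), Yw 𝒱.one w n = if n = 0 then w else 0
  weak_assoc : ∀ (u v : V) (w : W), ∃ k : ℕ, ∀ a b : ℤ,
    mulAddPow k (substAdd02 fun m n => Yw u (Yw v w n) m) a b
      = mulAddPow k (fun a' b' => Yw (𝒱.Y u v a') w b') a b

section Twist

variable {U V : Type*} [AddCommGroup U] [Module ℂ U] [AddCommGroup V] [Module ℂ V]

/-- Coefficient of `x₁^m x₂^n` in `(Y(x₂)⊗1)R²³(x₁)R¹²(x₁+x₂)` applied to `v ⊗ u ⊗ u'`. -/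
def hex1RHS (𝒰 : NLVA U) (Rc : ℤ → (V ⊗[ℂ] U →ₗ[ℂ] U ⊗[ℂ] V))
    (v : V) (u u' : U) (m n : ℤ) : U ⊗[ℂ] V :=
  ∑ᶠ (i : ℕ) (c : ℤ),
    ((zchoose (m - c + i) i : ℤ) : ℂ) •
      (TensorProduct.map (TensorProduct.lift (𝒰.Yc (n - i))) LinearMap.id)
        ((TensorProduct.assoc ℂ U U V).symm
          ((LinearMap.lTensor U (Rc c))
            ((TensorProduct.assoc ℂ U V U)
              ((Rc (m - c + i) (v ⊗ₜ u)) ⊗ₜ u'))))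

/-- Coefficient of `x₁^m x₂^n` in `(1⊗Y(x₂))R¹²(x₁-x₂)R²³(x₁)` applied to `v ⊗ v' ⊗ u`. -/
def hex2RHS (𝒱 : NLVA V) (Rc : ℤ → (V ⊗[ℂ] U →ₗ[ℂ] U ⊗[ℂ] V))
    (v v' : V) (u : U) (m n : ℤ) : U ⊗[ℂ] V :=
  ∑ᶠ (i : ℕ) (c : ℤ),
    ((-1 : ℂ) ^ i * ((zchoose (m - c + i) i : ℤ) : ℂ)) •
      (LinearMap.lTensor U (TensorProduct.lift (𝒱.Yc (n - i))))
        ((TensorProduct.assoc ℂ U V V)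
          ((TensorProduct.map (Rc (m - c + i)) LinearMap.id)
            ((TensorProduct.assoc ℂ V U V).symm
              (v ⊗ₜ (Rc c (v' ⊗ₜ u))))))

/-- A twisting operator `R(x) : V ⊗ U → U ⊗ V ⊗ ℂ((x))` for the ordered pair `(U,V)`,
given by its family of coefficients `Rc n`. -/
structure TwistingOp (𝒰 : NLVA U) (𝒱 : NLVA V) where
  Rc : ℤ → (V ⊗[ℂ] U →ₗ[ℂ] U ⊗[ℂ] V)
  laurent : ∀ t : V ⊗[ℂ] U, IsTensorLaurent fun n => Rc n t
  vac_right : ∀ (v : V) (n : ℤ),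
    Rc n (v ⊗ₜ 𝒰.one) = if n = 0 then 𝒰.one ⊗ₜ v else 0
  vac_left : ∀ (u : U) (n : ℤ),
    Rc n (𝒱.one ⊗ₜ u) = if n = 0 then u ⊗ₜ 𝒱.one else 0
  hex1 : ∀ (v : V) (u u' : U) (m n : ℤ),
    Rc m (v ⊗ₜ (𝒰.Y u u' n)) = hex1RHS 𝒰 Rc v u u' m n
  hex2 : ∀ (v v' : V) (u : U) (m n : ℤ),
    Rc m ((𝒱.Y v v' n) ⊗ₜ u) = hex2RHS 𝒱 Rc v v' u m n

/-- `Sc` is a two-sided inverse of `Rc` as `ℂ((x))`-linear maps (coefficientwise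
convolution), with values in the tensor with `ℂ((x))`. -/
def IsInvPair {A B : Type*} [AddCommGroup A] [Module ℂ A] [AddCommGroup B] [Module ℂ B]
    (Rc : ℤ → (A →ₗ[ℂ] B)) (Sc : ℤ → (B →ₗ[ℂ] A)) : Prop :=
  (∀ t : B, IsTensorLaurent fun n => Sc n t) ∧
  (∀ (t : A) (n : ℤ), (∑ᶠ c : ℤ, Sc c (Rc (n - c) t)) = if n = 0 then t else 0) ∧
  (∀ (t : B) (n : ℤ), (∑ᶠ c : ℤ, Rc c (Sc (n - c) t)) = if n = 0 then t else 0)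

/-- The canonical embedding `u ↦ u ⊗ 𝟙`. -/
def iotaU (𝒱 : NLVA V) : U →ₗ[ℂ] U ⊗[ℂ] V := (TensorProduct.mk ℂ U V).flip 𝒱.one

/-- The canonical embedding `v ↦ 𝟙 ⊗ v`. -/
def iotaV (𝒰 : NLVA U) : V →ₗ[ℂ] U ⊗[ℂ] V := TensorProduct.mk ℂ U V 𝒰.one

/-- The operator `D ⊗ 1 + 1 ⊗ D` on `U ⊗ V`. -/
def DUV (𝒰 : NLVA U) (𝒱 : NLVA V) : U ⊗[ℂ] V →ₗ[ℂ] U ⊗[ℂ] V :=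
  LinearMap.rTensor V 𝒰.D + LinearMap.lTensor U 𝒱.D

/-- The coefficient of `x^n` in `Y_R(u⊗v, x)(u'⊗v') = (Y(x)⊗Y(x))R²³(-x)(u⊗v⊗u'⊗v')`. -/
def YRcoef (𝒰 : NLVA U) (𝒱 : NLVA V) (Rop : TwistingOp 𝒰 𝒱)
    (u : U) (v : V) (u' : U) (v' : V) (n : ℤ) : U ⊗[ℂ] V :=
  ∑ᶠ (c : ℤ) (a : ℤ),
    ((-1 : ℂ) ^ c) •
      (TensorProduct.map (𝒰.Yc a u) ((𝒱.Yc (n - c - a)).flip v'))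
        (Rop.Rc c (v ⊗ₜ u'))

/-- `𝒯` is the twisted tensor product nonlocal vertex algebra `U ⊗_R V`. -/
def IsTwistedTensor (𝒰 : NLVA U) (𝒱 : NLVA V) (Rop : TwistingOp 𝒰 𝒱)
    (𝒯 : NLVA (U ⊗[ℂ] V)) : Prop :=
  𝒯.one = 𝒰.one ⊗ₜ 𝒱.one ∧
  ∀ (u u' : U) (v v' : V) (n : ℤ),
    𝒯.Y (u ⊗ₜ v) (u' ⊗ₜ v') n = YRcoef 𝒰 𝒱 Rop u v u' v' n

end Twist

section Aux

variable {A B W T : Type*} [AddCommGroup A] [Module ℂ A] [AddCommGroup B] [Module ℂ B]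
  [AddCommGroup W] [Module ℂ W] [AddCommGroup T] [Module ℂ T]

/-- The linear map `(a ⊗ b) ↦ Y_A(a)_e (Y_B(b)_j w)`, i.e. the coefficient
of `Y_A(x₂)(1 ⊗ Y_B(x₁)) (· ⊗ · ⊗ w)` at `x₂^e x₁^j`. -/
def sandwichMod (YA : A →ₗ[ℂ] W →ₗ[ℂ] (ℤ → W)) (YB : B →ₗ[ℂ] W →ₗ[ℂ] (ℤ → W))
    (w : W) (e j : ℤ) : A ⊗[ℂ] B →ₗ[ℂ] W :=
  TensorProduct.lift
    ((YA.compr₂ (LinearMap.proj e)).compl₂ ((YB.compr₂ (LinearMap.proj j)).flip w))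

/-- Coefficient of `x₁^m x₂^n` in `Y_A(x₂)(1 ⊗ Y_B(x₁)) q(x₂ - x₁) (⋯ ⊗ w)`, where the
series `q` is evaluated at `x₂ - x₁`, expanded in nonnegative powers of `x₁`. -/
def twistRHS (YA : A →ₗ[ℂ] W →ₗ[ℂ] (ℤ → W)) (YB : B →ₗ[ℂ] W →ₗ[ℂ] (ℤ → W))
    (q : ℤ → A ⊗[ℂ] B) (w : W) : ℤ → ℤ → W := fun m n =>
  ∑ᶠ (i : ℕ) (p : ℤ),
    ((-1 : ℂ) ^ i * ((zchoose p i : ℤ) : ℂ)) •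
      sandwichMod YA YB w (n - p + i) (m - i) (q p)

/-- As `twistRHS`, but with `q` evaluated at `-x₂ + x₁`, expanded in nonnegative
powers of `x₂`. -/
def twistRHSalt (YA : A →ₗ[ℂ] W →ₗ[ℂ] (ℤ → W)) (YB : B →ₗ[ℂ] W →ₗ[ℂ] (ℤ → W))
    (q : ℤ → A ⊗[ℂ] B) (w : W) : ℤ → ℤ → W := fun m n =>
  ∑ᶠ (i : ℕ) (p : ℤ),
    ((-1 : ℂ) ^ i * ((zchoose p i : ℤ) : ℂ)) •
      sandwichMod YA YB w (n - i) (m - p + i) (q p)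

/-- Coefficient of `x^n` in `e^{xD} F(x)` where `F` is given by its coefficients. -/
def expD (Dop : T →ₗ[ℂ] T) (F : ℤ → T) (n : ℤ) : T :=
  ∑ᶠ j : ℕ, ((j.factorial : ℂ))⁻¹ • (Dop ^ j) (F (n - j))

end Aux

section YBE

variable {V : Type*} [AddCommGroup V] [Module ℂ V]

/-- The flip of the last two tensor factors of `(V⊗V)⊗V`. -/
def swap23 : (V ⊗[ℂ] V) ⊗[ℂ] V →ₗ[ℂ] (V ⊗[ℂ] V) ⊗[ℂ] V :=
  ((TensorProduct.assoc ℂ V V V).symm.toLinearMap).comp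
    ((LinearMap.lTensor V (TensorProduct.comm ℂ V V).toLinearMap).comp
      (TensorProduct.assoc ℂ V V V).toLinearMap)

/-- `S¹²` acting on `(V⊗V)⊗V`. -/
def S12m (Sc : ℤ → (V ⊗[ℂ] V →ₗ[ℂ] V ⊗[ℂ] V)) (c : ℤ) :
    (V ⊗[ℂ] V) ⊗[ℂ] V →ₗ[ℂ] (V ⊗[ℂ] V) ⊗[ℂ] V :=
  TensorProduct.map (Sc c) LinearMap.id

/-- `S²³` acting on `(V⊗V)⊗V`. -/
def S23m (Sc : ℤ → (V ⊗[ℂ] V →ₗ[ℂ] V ⊗[ℂ] V)) (c : ℤ) :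
    (V ⊗[ℂ] V) ⊗[ℂ] V →ₗ[ℂ] (V ⊗[ℂ] V) ⊗[ℂ] V :=
  ((TensorProduct.assoc ℂ V V V).symm.toLinearMap).comp
    ((LinearMap.lTensor V (Sc c)).comp (TensorProduct.assoc ℂ V V V).toLinearMap)

/-- `S¹³` acting on `(V⊗V)⊗V`. -/
def S13m (Sc : ℤ → (V ⊗[ℂ] V →ₗ[ℂ] V ⊗[ℂ] V)) (c : ℤ) :
    (V ⊗[ℂ] V) ⊗[ℂ] V →ₗ[ℂ] (V ⊗[ℂ] V) ⊗[ℂ] V :=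
  swap23.comp ((S12m Sc c).comp swap23)

/-- `S²¹(x) = σ S(x) σ`. -/
def S21c (Sc : ℤ → (V ⊗[ℂ] V →ₗ[ℂ] V ⊗[ℂ] V)) (c : ℤ) :
    V ⊗[ℂ] V →ₗ[ℂ] V ⊗[ℂ] V :=
  ((TensorProduct.comm ℂ V V).toLinearMap).comp
    ((Sc c).comp (TensorProduct.comm ℂ V V).toLinearMap)

/-- The quantum Yang–Baxter equation
`S¹²(x)S¹³(x+z)S²³(z) = S²³(z)S¹³(x+z)S¹²(x)` (coefficient of `x^a z^b`, with
`S¹³(x+z)` expanded in nonnegative powers of `z`). -/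
def QYBE (Sc : ℤ → (V ⊗[ℂ] V →ₗ[ℂ] V ⊗[ℂ] V)) : Prop :=
  ∀ (t : (V ⊗[ℂ] V) ⊗[ℂ] V) (a b : ℤ),
    (∑ᶠ (i : ℕ) (p : ℤ), ((zchoose p i : ℤ) : ℂ) •
        S12m Sc (a - p + i) (S13m Sc p (S23m Sc (b - i) t)))
      = ∑ᶠ (i : ℕ) (p : ℤ), ((zchoose p i : ℤ) : ℂ) •
          S23m Sc (b - i) (S13m Sc p (S12m Sc (a - p + i) t))

/-- Unitarity: `S(x) S²¹(-x) = 1`. -/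
def Unitary (Sc : ℤ → (V ⊗[ℂ] V →ₗ[ℂ] V ⊗[ℂ] V)) : Prop :=
  ∀ (t : V ⊗[ℂ] V) (n : ℤ),
    (∑ᶠ c : ℤ, ((-1 : ℂ) ^ (n - c)) • Sc c (S21c Sc (n - c) t))
      = if n = 0 then t else 0

/-- `[D ⊗ 1, S(x)] = -(d/dx) S(x)`. -/
def DComm1 (𝒱 : NLVA V) (Sc : ℤ → (V ⊗[ℂ] V →ₗ[ℂ] V ⊗[ℂ] V)) : Prop :=
  ∀ (t : V ⊗[ℂ] V) (n : ℤ),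
    (LinearMap.rTensor V 𝒱.D) (Sc n t) - Sc n ((LinearMap.rTensor V 𝒱.D) t)
      = (-((n : ℂ) + 1)) • Sc (n + 1) t

/-- `Y(u,x)v = e^{xD} Y(-x) S(-x)(v⊗u)`. -/
def SkewS (𝒱 : NLVA V) (Sc : ℤ → (V ⊗[ℂ] V →ₗ[ℂ] V ⊗[ℂ] V)) : Prop :=
  ∀ (u v : V) (n : ℤ),
    𝒱.Y u v n = expD 𝒱.D (fun p => ((-1 : ℂ) ^ p) •
      ∑ᶠ c : ℤ, (TensorProduct.lift (𝒱.Yc (p - c))) (Sc c (v ⊗ₜ u))) n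

/-- `S(x₁)(Y(x₂)⊗1) = (Y(x₂)⊗1)S²³(x₁)S¹³(x₁+x₂)`. -/
def HexY1 (𝒱 : NLVA V) (Sc : ℤ → (V ⊗[ℂ] V →ₗ[ℂ] V ⊗[ℂ] V)) : Prop :=
  ∀ (t : (V ⊗[ℂ] V) ⊗[ℂ] V) (m n : ℤ),
    Sc m ((TensorProduct.map (TensorProduct.lift (𝒱.Yc n)) LinearMap.id) t)
      = ∑ᶠ (i : ℕ) (p : ℤ), ((zchoose p i : ℤ) : ℂ) •
          (TensorProduct.map (TensorProduct.lift (𝒱.Yc (n - i))) LinearMap.id)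
            (S23m Sc (m - p + i) (S13m Sc p t))

/-- `S(x₁)(1⊗Y(x₂)) = (1⊗Y(x₂))S¹²(x₁-x₂)S¹³(x₁)`. -/
def HexY2 (𝒱 : NLVA V) (Sc : ℤ → (V ⊗[ℂ] V →ₗ[ℂ] V ⊗[ℂ] V)) : Prop :=
  ∀ (t : (V ⊗[ℂ] V) ⊗[ℂ] V) (m n : ℤ),
    Sc m ((LinearMap.lTensor V (TensorProduct.lift (𝒱.Yc n)))
        ((TensorProduct.assoc ℂ V V V) t))
      = ∑ᶠ (i : ℕ) (p : ℤ), ((-1 : ℂ) ^ i * ((zchoose p i : ℤ) : ℂ)) •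
          (LinearMap.lTensor V (TensorProduct.lift (𝒱.Yc (n - i))))
            ((TensorProduct.assoc ℂ V V V)
              (S12m Sc p (S13m Sc (m - p + i) t)))

/-- A quantum vertex algebra `(V, 𝒮)`. -/
structure QVA (V : Type*) [AddCommGroup V] [Module ℂ V] where
  alg : NLVA V
  sloc : SLocal alg
  Sc : ℤ → (V ⊗[ℂ] V →ₗ[ℂ] V ⊗[ℂ] V)
  laurent : ∀ t : V ⊗[ℂ] V, IsTensorLaurent fun n => Sc n t
  qybe : QYBE Sc
  unitary : Unitary Sc
  vac : ∀ (v : V) (n : ℤ), Sc n (alg.one ⊗ₜ v) = if n = 0 then alg.one ⊗ₜ v else 0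
  dcomm : DComm1 alg Sc
  skew : SkewS alg Sc
  hex : HexY1 alg Sc

end YBE

section Bialg

variable {H : Type*} [AddCommGroup H] [Module ℂ H]

/-- A nonlocal vertex bialgebra. -/
structure NLVBialg (H : Type*) [AddCommGroup H] [Module ℂ H] where
  alg : NLVA H
  comul : H →ₗ[ℂ] H ⊗[ℂ] H
  counit : H →ₗ[ℂ] ℂ
  coassoc : ∀ h : H, (LinearMap.lTensor H comul) (comul h)
      = (TensorProduct.assoc ℂ H H H) ((LinearMap.rTensor H comul) (comul h))
  counit_comul_left : ∀ h : H,
      (TensorProduct.lid ℂ H) ((LinearMap.rTensor H counit) (comul h)) = h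
  counit_comul_right : ∀ h : H,
      (TensorProduct.rid ℂ H) ((LinearMap.lTensor H counit) (comul h)) = h
  counit_one : counit alg.one = 1
  counit_mul : ∀ (a b : H) (n : ℤ),
      counit (alg.Y a b n) = if n = 0 then counit a * counit b else 0
  comul_one : comul alg.one = alg.one ⊗ₜ alg.one
  comul_mul : ∀ (a b : H) (n : ℤ),
      comul (alg.Y a b n)
        = ∑ᶠ p : ℤ, (TensorProduct.map₂ (alg.Yc p) (alg.Yc (n - p))) (comul a) (comul b)

/-- A nonlocal vertex `H`-module-algebra. -/
structure NLVModAlg (𝓗 : NLVBialg H) (U : Type*) [AddCommGroup U] [Module ℂ U] where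
  alg : NLVA U
  act : NLVAModule 𝓗.alg U
  scalar : ∀ (h : H) (u : U), IsTensorLaurent fun n => act.Yw h u n
  vac : ∀ (h : H) (n : ℤ),
      act.Yw h alg.one n = if n = 0 then 𝓗.counit h • alg.one else 0
  compat : ∀ (h : H) (u v : U) (m n : ℤ),
      act.Yw h (alg.Y u v n) m
        = ∑ᶠ (i : ℕ) (p : ℤ), ((-1 : ℂ) ^ i * ((zchoose p i : ℤ) : ℂ)) •
            (TensorProduct.lift
              (((alg.Yc (n - i)).comp ((act.Yw.compr₂ (LinearMap.proj p)).flip u)).compl₂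
                ((act.Yw.compr₂ (LinearMap.proj (m - p + i))).flip v)))
            (𝓗.comul h)

/-- A nonlocal vertex `H`-comodule-algebra. -/
structure NLVComodAlg (𝓗 : NLVBialg H) (V : Type*) [AddCommGroup V] [Module ℂ V] where
  alg : NLVA V
  rho : V →ₗ[ℂ] H ⊗[ℂ] V
  coassoc : ∀ v : V, (LinearMap.lTensor H rho) (rho v)
      = (TensorProduct.assoc ℂ H H V) ((LinearMap.rTensor V 𝓗.comul) (rho v))
  counit_rho : ∀ v : V,
      (TensorProduct.lid ℂ V) ((LinearMap.rTensor V 𝓗.counit) (rho v)) = v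
  rho_one : rho alg.one = 𝓗.alg.one ⊗ₜ alg.one
  rho_mul : ∀ (v v' : V) (n : ℤ),
      rho (alg.Y v v' n)
        = ∑ᶠ p : ℤ, (TensorProduct.map₂ (𝓗.alg.Yc p) (alg.Yc (n - p))) (rho v) (rho v')

/-- The coefficient of `x^n` in
`Y_♯(u⊗v, x)(u'⊗v') = Y(u,x)Y(b¹(v),x)u' ⊗ Y(v²,x)v'`. -/
def Ysharp (𝓗 : NLVBialg H) {U V : Type*} [AddCommGroup U] [Module ℂ U]
    [AddCommGroup V] [Module ℂ V] (MU : NLVModAlg 𝓗 U) (CV : NLVComodAlg 𝓗 V)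
    (u : U) (v : V) (u' : U) (v' : V) (n : ℤ) : U ⊗[ℂ] V :=
  ∑ᶠ (a : ℤ) (p : ℤ),
    (TensorProduct.map
      ((MU.alg.Yc a u).comp ((MU.act.Yw.compr₂ (LinearMap.proj p)).flip u'))
      ((CV.alg.Yc (n - a - p)).flip v'))
    (CV.rho v)

/-- Rearrangement `(H⊗V)⊗U → (H⊗U)⊗V`. -/
def smashSwap {U V : Type*} [AddCommGroup U] [Module ℂ U]
    [AddCommGroup V] [Module ℂ V] :
    (H ⊗[ℂ] V) ⊗[ℂ] U →ₗ[ℂ] (H ⊗[ℂ] U) ⊗[ℂ] V :=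
  ((TensorProduct.assoc ℂ H U V).symm.toLinearMap).comp
    ((LinearMap.lTensor H (TensorProduct.comm ℂ V U).toLinearMap).comp
      (TensorProduct.assoc ℂ H V U).toLinearMap)

/-- The coefficient of `x^n` in `R(x)(v⊗u) = Y(b¹(v),-x)u ⊗ v²`. -/
def Rsmash (𝓗 : NLVBialg H) {U V : Type*} [AddCommGroup U] [Module ℂ U]
    [AddCommGroup V] [Module ℂ V] (MU : NLVModAlg 𝓗 U) (CV : NLVComodAlg 𝓗 V)
    (n : ℤ) : V ⊗[ℂ] U →ₗ[ℂ] U ⊗[ℂ] V :=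
  ((-1 : ℂ) ^ n) •
    ((TensorProduct.map
        (TensorProduct.lift (MU.act.Yw.compr₂ (LinearMap.proj n))) LinearMap.id).comp
      (smashSwap.comp (LinearMap.rTensor U CV.rho)))

end Bialg

theorem zchoose_eq_ringChoose (n : ℤ) (k : ℕ) : zchoose n k = Ring.choose n k := by
  unfold zchoose
  split_ifs with h
  · lift n to ℕ using h
    simp [Ring.choose_natCast]
  · obtain ⟨m, rfl⟩ : ∃ m : ℕ, n = -(m + 1 : ℤ) := ⟨(-n - 1).toNat, by omega⟩
    rw [Ring.choose_neg]
    have h1 : ((m : ℤ) + 1 + k - 1) = ((m + k : ℕ) : ℤ) := by push_cast; ring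
    have h2 : ((k : ℤ) - -((m : ℤ) + 1) - 1).toNat = m + k := by omega
    rw [h1, h2, Ring.choose_natCast]
    simp [Int.negOnePow_def, Units.smul_def]

theorem zchoose_add (p q : ℤ) (k : ℕ) :
    zchoose (p + q) k
      = ∑ ij ∈ Finset.HasAntidiagonal.antidiagonal k, zchoose p ij.1 * zchoose q ij.2 := by
  simp only [zchoose_eq_ringChoose]
  exact Ring.add_choose_eq k (Commute.all p q)

theorem zchoose_zero_left (k : ℕ) : zchoose 0 k = if k = 0 then 1 else 0 := by
  rw [zchoose_eq_ringChoose, Ring.choose_zero_ite]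

theorem Submodule.finsum_mem' {ι W : Type*} [AddCommGroup W] [Module ℂ W]
    (F : Submodule ℂ W) {f : ι → W} (h : ∀ i, f i ∈ F) : ∑ᶠ i, f i ∈ F :=
  finsum_induction (· ∈ F) F.zero_mem (fun _ _ => F.add_mem) h

section Convolution

variable {W W' W'' : Type*} [AddCommGroup W] [Module ℂ W] [AddCommGroup W'] [Module ℂ W']
  [AddCommGroup W''] [Module ℂ W'']

/-- The action of a series `A(x)` of linear maps on a vector valued series `a(x)`. -/
def conv (A : ℤ → W →ₗ[ℂ] W') (a : ℤ → W) (n : ℤ) : W' := ∑ᶠ c : ℤ, A c (a (n - c))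

/-- `A(x)` is a linear map `W → W' ⊗ ℂ((x))`. -/
def IsTensorLaurentMap (A : ℤ → W →ₗ[ℂ] W') : Prop := ∀ w, IsTensorLaurent fun n => A n w

/-- The family of coefficients of `(-1)^i / i! (d/dx)^i A(x)`. -/
def hasse (A : ℤ → W →ₗ[ℂ] W') (i : ℕ) (q : ℤ) : W →ₗ[ℂ] W' :=
  ((-1 : ℂ) ^ i * ((zchoose (q + i) i : ℤ) : ℂ)) • A (q + i)

theorem IsTensorLaurent.add {a b : ℤ → W} (ha : IsTensorLaurent a) (hb : IsTensorLaurent b) :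
    IsTensorLaurent fun n => a n + b n := by
  obtain ⟨⟨N, hN⟩, F, hF, haF⟩ := ha
  obtain ⟨⟨M, hM⟩, G, hG, hbG⟩ := hb
  refine ⟨⟨min N M, fun n hn => ?_⟩, F ⊔ G, hF.sup hG, fun n => ?_⟩
  · simp [hN n (by omega), hM n (by omega)]
  · exact add_mem (Submodule.mem_sup_left (haF n)) (Submodule.mem_sup_right (hbG n))

theorem IsTensorLaurent.sum {ι : Type*} (s : Finset ι) {a : ι → ℤ → W}
    (ha : ∀ i ∈ s, IsTensorLaurent (a i)) : IsTensorLaurent fun n => ∑ i ∈ s, a i n := by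
  classical
  induction s using Finset.induction_on with
  | empty => exact ⟨⟨0, fun n _ => by simp⟩, ⊥, Submodule.fg_bot, fun n => by simp⟩
  | insert i s hi ih =>
    simp only [Finset.sum_insert hi]
    exact (ha i (by simp)).add (ih fun j hj => ha j (by simp [hj]))

theorem IsTensorLaurent.map {a : ℤ → W} (ha : IsTensorLaurent a) (f : W →ₗ[ℂ] W') :
    IsTensorLaurent fun n => f (a n) := by
  obtain ⟨⟨N, hN⟩, F, hF, haF⟩ := ha
  refine ⟨⟨N, fun n hn => ?_⟩, F.map f, hF.map f, fun n => ⟨_, haF n, rfl⟩⟩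
  simp [hN n hn]

theorem IsTensorLaurent.unit_mul {a : ℤ → W} (ha : IsTensorLaurent a) (f : ℤ → ℂ) :
    IsTensorLaurent fun n => f n • a n := by
  obtain ⟨⟨N, hN⟩, F, hF, haF⟩ := ha
  exact ⟨⟨N, fun n hn => by simp [hN n hn]⟩, F, hF, fun n => F.smul_mem _ (haF n)⟩

/-- A pointwise lower truncated family is uniformly truncated on finitely generated subspaces. -/
theorem exists_bound_of_fg {A : ℤ → W →ₗ[ℂ] W'} (hA : ∀ w, IsLaurent fun n => A n w)
    {F : Submodule ℂ W} (hF : F.FG) : ∃ N : ℤ, ∀ w ∈ F, ∀ c < N, A c w = 0 := by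
  induction F, hF using Submodule.fg_induction with
  | singleton x =>
    obtain ⟨N, hN⟩ := hA x
    refine ⟨N, fun w hw c hc => ?_⟩
    obtain ⟨r, rfl⟩ := Submodule.mem_span_singleton.1 hw
    simp [hN c hc]
  | sup F G _ _ hF hG =>
    obtain ⟨N, hN⟩ := hF
    obtain ⟨M, hM⟩ := hG
    refine ⟨min N M, fun w hw c hc => ?_⟩
    obtain ⟨u, hu, v, hv, rfl⟩ := Submodule.mem_sup.1 hw
    simp [hN u hu c (by omega), hM v hv c (by omega)]

theorem IsTensorLaurentMap.exists_fg {A : ℤ → W →ₗ[ℂ] W'} (hA : IsTensorLaurentMap A)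
    {F : Submodule ℂ W} (hF : F.FG) :
    ∃ G : Submodule ℂ W', G.FG ∧ ∀ w ∈ F, ∀ c, A c w ∈ G := by
  induction F, hF using Submodule.fg_induction with
  | singleton x =>
    obtain ⟨-, G, hG, hGx⟩ := hA x
    refine ⟨G, hG, fun w hw c => ?_⟩
    obtain ⟨r, rfl⟩ := Submodule.mem_span_singleton.1 hw
    simpa using G.smul_mem r (hGx c)
  | sup F₁ F₂ _ _ h₁ h₂ =>
    obtain ⟨G₁, hG₁, h₁⟩ := h₁
    obtain ⟨G₂, hG₂, h₂⟩ := h₂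
    refine ⟨G₁ ⊔ G₂, hG₁.sup hG₂, fun w hw c => ?_⟩
    obtain ⟨u, hu, v, hv, rfl⟩ := Submodule.mem_sup.1 hw
    rw [map_add]
    exact add_mem (Submodule.mem_sup_left (h₁ u hu c)) (Submodule.mem_sup_right (h₂ v hv c))

theorem IsTensorLaurentMap.isLaurent {A : ℤ → W →ₗ[ℂ] W'} (hA : IsTensorLaurentMap A) (w : W) :
    IsLaurent fun n => A n w := (hA w).1

theorem IsTensorLaurentMap.exists_bound {A : ℤ → W →ₗ[ℂ] W'} (hA : IsTensorLaurentMap A)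
    {a : ℤ → W} (ha : IsTensorLaurent a) :
    ∃ N : ℤ, (∀ c < N, ∀ k, A c (a k) = 0) ∧ ∀ k < N, a k = 0 := by
  obtain ⟨⟨N, hN⟩, F, hF, haF⟩ := ha
  obtain ⟨M, hM⟩ := exists_bound_of_fg hA.isLaurent hF
  exact ⟨min N M, fun c hc k => hM _ (haF k) c (by omega), fun k hk => hN k (by omega)⟩

theorem hasFiniteSupport_of_Icc {X : Type*} [AddCommGroup X] {f : ℤ → X} (N M : ℤ)
    (h : ∀ c, c < N ∨ M < c → f c = 0) :
    f.HasFiniteSupport :=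
  (Set.finite_Icc N M).subset fun c hc => by
    by_contra hc'
    exact hc (h c (by rw [Set.mem_Icc] at hc'; omega))

theorem hasFiniteSupport_conv {A : ℤ → W →ₗ[ℂ] W'} (hA : IsTensorLaurentMap A)
    {a : ℤ → W} (ha : IsTensorLaurent a) (n : ℤ) :
    (fun c => A c (a (n - c))).HasFiniteSupport := by
  obtain ⟨N, hN, hN'⟩ := hA.exists_bound ha
  refine hasFiniteSupport_of_Icc N (n - N) fun c hc => ?_
  rcases hc with hc | hc
  · exact hN c hc _
  · simp [hN' (n - c) (by omega)]

theorem conv_mem {A : ℤ → W →ₗ[ℂ] W'} {a : ℤ → W} {G : Submodule ℂ W'}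
    (h : ∀ c k, A c (a k) ∈ G) (n : ℤ) : conv A a n ∈ G :=
  G.finsum_mem' fun _ => h _ _

theorem IsTensorLaurentMap.conv {A : ℤ → W →ₗ[ℂ] W'} (hA : IsTensorLaurentMap A)
    {a : ℤ → W} (ha : IsTensorLaurent a) : IsTensorLaurent (conv A a) := by
  obtain ⟨N, hN, hN'⟩ := hA.exists_bound ha
  obtain ⟨-, F, hF, haF⟩ := ha
  obtain ⟨G, hG, hAG⟩ := hA.exists_fg hF
  refine ⟨⟨N + N, fun n hn => finsum_eq_zero_of_forall_eq_zero fun c => ?_⟩, G, hG,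
    conv_mem fun c k => hAG _ (haF k) c⟩
  by_cases hc : c < N
  · exact hN c hc _
  · simp [hN' (n - c) (by omega)]

theorem conv_add {A : ℤ → W →ₗ[ℂ] W'} (hA : IsTensorLaurentMap A)
    {a b : ℤ → W} (ha : IsTensorLaurent a) (hb : IsTensorLaurent b) (n : ℤ) :
    _root_.conv A (fun k => a k + b k) n = _root_.conv A a n + _root_.conv A b n := by
  simp only [_root_.conv, map_add]
  exact finsum_add_distrib (hasFiniteSupport_conv hA ha n) (hasFiniteSupport_conv hA hb n)

theorem conv_sum {ι : Type*} {A : ℤ → W →ₗ[ℂ] W'} (hA : IsTensorLaurentMap A) (s : Finset ι)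
    {a : ι → ℤ → W} (ha : ∀ i ∈ s, IsTensorLaurent (a i)) (n : ℤ) :
    _root_.conv A (fun k => ∑ i ∈ s, a i k) n = ∑ i ∈ s, _root_.conv A (a i) n := by
  simp only [_root_.conv, map_sum]
  exact finsum_sum_comm s _ fun i hi => hasFiniteSupport_conv hA (ha i hi) n

/-- Bounds showing that both iterated sums for `A(x)B(x)a(x)` are finite. -/
theorem exists_bound_conv_conv {A : ℤ → W' →ₗ[ℂ] W''} {B : ℤ → W →ₗ[ℂ] W'}
    (hA : IsTensorLaurentMap A) (hB : IsTensorLaurentMap B)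
    {a : ℤ → W} (ha : IsTensorLaurent a) :
    ∃ N : ℤ, ∀ c d k, c < N ∨ d < N ∨ k < N → A c (B d (a k)) = 0 := by
  obtain ⟨N, hN, hN'⟩ := hB.exists_bound ha
  obtain ⟨-, F, hF, haF⟩ := ha
  obtain ⟨G, hG, hBG⟩ := hB.exists_fg hF
  obtain ⟨M, hM⟩ := exists_bound_of_fg hA.isLaurent hG
  refine ⟨min N M, fun c d k h => ?_⟩
  rcases h with h | h | h
  · exact hM _ (hBG _ (haF k) d) c (by omega)
  · simp [hN d (by omega) k]
  · simp [hN' k (by omega)]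

theorem hasFiniteSupport_conv_comp {A : ℤ → W' →ₗ[ℂ] W''} {B : ℤ → W →ₗ[ℂ] W'}
    (hA : IsTensorLaurentMap A) (hB : IsTensorLaurentMap B)
    {a : ℤ → W} (ha : IsTensorLaurent a) (n : ℤ) :
    (fun c => conv A (fun d => B d (a (n - c))) c).HasFiniteSupport := by
  obtain ⟨N, hN⟩ := exists_bound_conv_conv hA hB ha
  refine hasFiniteSupport_of_Icc (N + N) (n - N) fun c hc =>
    finsum_eq_zero_of_forall_eq_zero fun d => hN _ _ _ (by omega)

theorem conv_conv {A : ℤ → W' →ₗ[ℂ] W''} {B : ℤ → W →ₗ[ℂ] W'}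
    (hA : IsTensorLaurentMap A) (hB : IsTensorLaurentMap B)
    {a : ℤ → W} (ha : IsTensorLaurent a) (n : ℤ) :
    conv A (conv B a) n = ∑ᶠ c, conv A (fun d => B d (a (n - c))) c := by
  obtain ⟨N, hN⟩ := exists_bound_conv_conv hA hB ha
  have hB' (d : ℤ) : conv B a (n - d) = ∑ᶠ e, B (e - d) (a (n - e)) := by
    rw [conv, ← finsum_comp_equiv (Equiv.subRight d)]
    exact finsum_congr fun e => by simp
  have hsupp (d : ℤ) : (fun e => B (e - d) (a (n - e))).HasFiniteSupport := by
    obtain ⟨M, hM, hM'⟩ := hB.exists_bound ha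
    refine hasFiniteSupport_of_Icc (d + M) (n - M) fun e he => ?_
    rcases he with he | he
    · exact hM _ (by omega) _
    · simp [hM' (n - e) (by omega)]
  have hL : conv A (conv B a) n
      = ∑ d ∈ Finset.Icc N (n - N - N), ∑ᶠ e, A d (B (e - d) (a (n - e))) := by
    have h (d : ℤ) : A d (conv B a (n - d)) = ∑ᶠ e, A d (B (e - d) (a (n - e))) := by
      rw [hB', map_finsum _ (hsupp d)]
    rw [conv, finsum_congr h]
    refine finsum_eq_sum_of_support_subset _ fun d hd => ?_
    by_contra hd'
    rw [Finset.coe_Icc, Set.mem_Icc] at hd'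
    exact hd (finsum_eq_zero_of_forall_eq_zero fun e => hN _ _ _ (by omega))
  have hR (e : ℤ) : conv A (fun d => B d (a (n - e))) e
      = ∑ d ∈ Finset.Icc N (n - N - N), A d (B (e - d) (a (n - e))) := by
    refine finsum_eq_sum_of_support_subset _ fun d hd => ?_
    by_contra hd'
    rw [Finset.coe_Icc, Set.mem_Icc] at hd'
    exact hd (hN _ _ _ (by omega))
  rw [hL, finsum_congr hR, finsum_sum_comm]
  intro d _
  exact (hsupp d).subset fun e he he' => he (by simp [he'])

theorem finsum_ite_sub_eq {X : Type*} [AddCommGroup X] (a : ℤ → X) (n : ℤ) :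
    (∑ᶠ c : ℤ, if c = 0 then a (n - c) else 0) = a n := by
  rw [finsum_eq_single _ 0 (by intro c hc; simp [hc])]
  simp

/-- If `A(x)B(x) = 1` then `A(x)(B(x)a(x)) = a(x)`. -/
theorem conv_conv_of_inverse {A : ℤ → W' →ₗ[ℂ] W} {B : ℤ → W →ₗ[ℂ] W'}
    (hA : IsTensorLaurentMap A) (hB : IsTensorLaurentMap B)
    (h : ∀ t n, conv A (fun d => B d t) n = if n = 0 then t else 0)
    {a : ℤ → W} (ha : IsTensorLaurent a) : conv A (conv B a) = a := by
  funext n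
  rw [conv_conv hA hB ha]
  simp only [h]
  exact finsum_ite_sub_eq a n

theorem IsTensorLaurentMap.hasse {A : ℤ → W →ₗ[ℂ] W'} (hA : IsTensorLaurentMap A) (i : ℕ) :
    IsTensorLaurentMap (hasse A i) := by
  intro w
  obtain ⟨⟨N, hN⟩, F, hF, hAF⟩ := hA w
  refine ⟨⟨N - i, fun n hn => ?_⟩, F, hF, fun n => F.smul_mem _ (hAF _)⟩
  have := hN (n + i) (by omega)
  simp only at this
  simp [_root_.hasse, this]

/-- The Leibniz rule for `A(x)B(x) = 1`. -/
theorem sum_antidiagonal_conv_hasse {A : ℤ → W' →ₗ[ℂ] W} {B : ℤ → W →ₗ[ℂ] W'}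
    (hA : IsTensorLaurentMap A) (hB : IsTensorLaurentMap B)
    (h : ∀ t n, conv A (fun d => B d t) n = if n = 0 then t else 0) (t : W) (k : ℕ) (n : ℤ) :
    ∑ ij ∈ Finset.HasAntidiagonal.antidiagonal k, conv (hasse A ij.1) (fun d => hasse B ij.2 d t) n
      = if n = 0 then (if k = 0 then t else 0) else 0 := by
  have hfin := hasFiniteSupport_conv hA (hB t) (n + k)
  have h1 : ∀ ij ∈ Finset.HasAntidiagonal.antidiagonal k, conv (hasse A ij.1) (fun d => hasse B ij.2 d t) n
      = ∑ᶠ c, (((-1 : ℂ) ^ k * (zchoose c ij.1 * zchoose (n + k - c) ij.2 : ℤ))) •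
          A c (B (n + k - c) t) := by
    rintro ⟨i, j⟩ hij
    obtain rfl := Finset.HasAntidiagonal.mem_antidiagonal.1 hij
    rw [conv]
    refine Eq.trans (finsum_congr fun c => ?_) (finsum_comp_equiv (Equiv.addRight (i : ℤ)))
    have e : n - c + (j : ℤ) = n + (i + j : ℕ) - (c + i) := by push_cast; ring
    simp only [hasse, LinearMap.smul_apply, map_smul, smul_smul, Equiv.coe_addRight, e, pow_add]
    congr 1
    push_cast
    ring
  rw [Finset.sum_congr rfl h1, ← finsum_sum_comm]
  · simp only [← Finset.sum_smul, ← Finset.mul_sum, ← Int.cast_sum]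
    have h2 (c : ℤ) : ∑ ij ∈ Finset.HasAntidiagonal.antidiagonal k, zchoose c ij.1 * zchoose (n + k - c) ij.2
        = zchoose (n + k) k := by
      rw [← zchoose_add]
      congr 1
      ring
    simp only [h2]
    rw [← smul_finsum]
    have h3 := h t (n + k)
    rw [conv] at h3
    rw [h3]
    by_cases hk : k = 0
    · subst hk
      by_cases hn : n = 0 <;> simp [hn, zchoose]
    · by_cases hn : n + k = 0 <;> simp [hk, hn, zchoose_zero_left]
  · intro ij _
    exact hfin.subset fun c hc hc' => hc (by simp [hc'])

theorem sum_antidiagonal_conv_hasse_conv_hasse {A : ℤ → W' →ₗ[ℂ] W} {B : ℤ → W →ₗ[ℂ] W'}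
    (hA : IsTensorLaurentMap A) (hB : IsTensorLaurentMap B)
    (h : ∀ t n, conv A (fun d => B d t) n = if n = 0 then t else 0)
    {a : ℤ → W} (ha : IsTensorLaurent a) (k : ℕ) (n : ℤ) :
    ∑ ij ∈ Finset.HasAntidiagonal.antidiagonal k, conv (hasse A ij.1) (conv (hasse B ij.2) a) n
      = if k = 0 then a n else 0 := by
  rw [Finset.sum_congr rfl fun ij _ => conv_conv (hA.hasse ij.1) (hB.hasse ij.2) ha n,
    ← finsum_sum_comm _ _ fun ij _ =>
      hasFiniteSupport_conv_comp (hA.hasse ij.1) (hB.hasse ij.2) ha n]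
  simp only [sum_antidiagonal_conv_hasse hA hB h]
  rw [finsum_ite_sub_eq (fun m => if k = 0 then a m else 0)]

/-- The coefficients of `Y(z) f(x - z, x)` with `Y(z) = ∑ y_n z^n`, expanded in nonnegative
powers of `z`, as finite sums over the powers of `z`. -/
theorem finsum_zchoose_eq_sum {y : ℤ → W →ₗ[ℂ] W'} {f : ℤ → ℤ → W} {m n : ℤ} {F : Submodule ℂ W}
    {M : ℕ} (hF : ∀ p q, f p q ∈ F) (hy : ∀ w ∈ F, ∀ i : ℕ, M ≤ i → y (n - i) w = 0)
    {N : ℤ} (hf : ∀ p q, p < N ∨ q < N → f p q = 0) :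
    (∑ᶠ (i : ℕ) (p : ℤ), ((-1 : ℂ) ^ i * ((zchoose p i : ℤ) : ℂ)) • y (n - i) (f p (m - p + i)))
      = ∑ i ∈ Finset.range M, y (n - i)
          (∑ᶠ p : ℤ, ((-1 : ℂ) ^ i * ((zchoose p i : ℤ) : ℂ)) • f p (m - p + i)) := by
  have h (i : ℕ) :
      ∑ᶠ p : ℤ, ((-1 : ℂ) ^ i * ((zchoose p i : ℤ) : ℂ)) • y (n - i) (f p (m - p + i))
        = y (n - i) (∑ᶠ p : ℤ, ((-1 : ℂ) ^ i * ((zchoose p i : ℤ) : ℂ)) • f p (m - p + i)) := by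
    rw [map_finsum]
    · simp only [map_smul]
    · exact hasFiniteSupport_of_Icc N (m + i - N) fun p hp => by rw [hf _ _ (by omega), smul_zero]
  rw [finsum_congr h]
  refine finsum_eq_sum_of_support_subset _ fun i hi => ?_
  by_contra hi'
  rw [Finset.coe_range, Set.mem_Iio, not_lt] at hi'
  exact hi (hy _ (F.finsum_mem' fun p => F.smul_mem _ (hF _ _)) i hi')

/-- If `T(x)Y(z) = Y(z)T₁₃(x)T₁₂(x - z)`, where `S`, `S₁₂`, `S₁₃` are inverse to `T`, `T₁₂`, `T₁₃`,
then `S(x)Y(z) = Y(z)S₁₂(x - z)S₁₃(x)`. -/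
theorem hexagon_of_inverse {S T : ℤ → W' →ₗ[ℂ] W'} {S₁₂ T₁₂ S₁₃ T₁₃ : ℤ → W →ₗ[ℂ] W}
    {y : ℤ → W →ₗ[ℂ] W'} (hS : IsTensorLaurentMap S) (hT : IsTensorLaurentMap T)
    (hS₁₂ : IsTensorLaurentMap S₁₂) (hT₁₂ : IsTensorLaurentMap T₁₂)
    (hS₁₃ : IsTensorLaurentMap S₁₃) (hT₁₃ : IsTensorLaurentMap T₁₃)
    (hy : ∀ w, IsLaurent fun n => y n w)
    (hST : ∀ t n, conv S (fun d => T d t) n = if n = 0 then t else 0)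
    (hTS₁₂ : ∀ t n, conv T₁₂ (fun d => S₁₂ d t) n = if n = 0 then t else 0)
    (hTS₁₃ : ∀ t n, conv T₁₃ (fun d => S₁₃ d t) n = if n = 0 then t else 0)
    (hex : ∀ w m n, T m (y n w) = ∑ᶠ (i : ℕ) (p : ℤ),
      ((-1 : ℂ) ^ i * ((zchoose p i : ℤ) : ℂ)) • y (n - i) (T₁₃ (m - p + i) (T₁₂ p w)))
    (t : W) (m n : ℤ) :
    S m (y n t) = ∑ᶠ (i : ℕ) (p : ℤ),
      ((-1 : ℂ) ^ i * ((zchoose p i : ℤ) : ℂ)) • y (n - i) (S₁₂ p (S₁₃ (m - p + i) t)) := by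
  obtain ⟨-, F₀, hF₀, hsF₀⟩ := hS₁₃ t
  obtain ⟨F₁, hF₁, h₁⟩ := hS₁₂.exists_fg hF₀
  obtain ⟨F₂, hF₂, h₂⟩ := hT₁₂.exists_fg hF₁
  obtain ⟨F₃, hF₃, h₃⟩ := hT₁₃.exists_fg hF₂
  obtain ⟨N, hN⟩ := exists_bound_of_fg hy (hF₁.sup hF₃)
  obtain ⟨M, hM, hM'⟩ : ∃ M : ℕ, 0 < M ∧ n - M < N := ⟨(n - N).toNat + 1, by omega, by omega⟩
  have hy₁ : ∀ w ∈ F₁, ∀ i : ℕ, M ≤ i → y (n - i) w = 0 := fun w hw i hi =>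
    hN w (Submodule.mem_sup_left hw) _ (by omega)
  have hy₃ : ∀ w ∈ F₃, ∀ i : ℕ, M ≤ i → y (n - i) w = 0 := fun w hw i hi =>
    hN w (Submodule.mem_sup_right hw) _ (by omega)
  set s : ℤ → W := fun d => S₁₃ d t with hs
  have hsL : IsTensorLaurent s := hS₁₃ t
  let X : ℕ → ℤ → W := fun j => conv (hasse S₁₂ j) s
  have hX : ∀ j, IsTensorLaurent (X j) := fun j => (hS₁₂.hasse j).conv hsL
  have hXF : ∀ j k, X j k ∈ F₁ := fun j k =>
    conv_mem (fun c l => F₁.smul_mem _ (h₁ _ (hsF₀ l) _)) k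
  have hrhs (m : ℤ) : (∑ᶠ (i : ℕ) (p : ℤ), ((-1 : ℂ) ^ i * ((zchoose p i : ℤ) : ℂ)) •
      y (n - i) (S₁₂ p (s (m - p + i)))) = ∑ j ∈ Finset.range M, y (n - j) (X j m) := by
    obtain ⟨K, hK, hK'⟩ := hS₁₂.exists_bound hsL
    rw [finsum_zchoose_eq_sum (f := fun p q => S₁₂ p (s q)) (F := F₁) (M := M) (N := K)
      (fun p q => h₁ _ (hsF₀ q) p) hy₁]
    · refine Finset.sum_congr rfl fun j _ => congrArg _ ?_
      simp only [X, conv]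
      rw [← finsum_comp_equiv (Equiv.addRight (j : ℤ))]
      refine finsum_congr fun c => ?_
      have e : m - (c + j) + j = m - c := by ring
      simp only [hasse, Equiv.coe_addRight, LinearMap.smul_apply, e]
    · rintro p q (h | h)
      · exact hK p h q
      · simp [hK' q h]
  let Z : ℕ → ℕ → ℤ → W := fun i j => conv T₁₃ (conv (hasse T₁₂ i) (X j))
  have hZF : ∀ i j k, Z i j k ∈ F₃ := fun i j k =>
    conv_mem (fun c l => h₃ _ (conv_mem (fun c l => F₂.smul_mem _ (h₂ _ (hXF j l) _)) l) c) k
  have hhex (j : ℕ) (m : ℤ) (w : W) (hw : w ∈ F₁) : T m (y (n - j) w)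
      = ∑ i ∈ Finset.range M, y (n - j - i) (conv T₁₃ (fun d => hasse T₁₂ i d w) m) := by
    obtain ⟨K, hK, hK'⟩ := hT₁₃.exists_bound (hT₁₂ w)
    rw [hex, finsum_zchoose_eq_sum (f := fun p q => T₁₃ q (T₁₂ p w)) (F := F₃) (M := M) (N := K)
      (fun p q => h₃ _ (h₂ _ hw p) q)]
    · refine Finset.sum_congr rfl fun i _ => congrArg _ ?_
      rw [conv, ← finsum_comp_equiv (Equiv.subLeft (m + i))]
      refine finsum_congr fun c => ?_
      have e1 : m - (m + i - c) + i = c := by ring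
      have e2 : m - c + i = m + i - c := by ring
      simp only [hasse, Equiv.subLeft_apply, LinearMap.smul_apply, map_smul, e1, e2]
    · intro w hw i hi
      have := hy₃ w hw (j + i) (by omega)
      rwa [Nat.cast_add, ← sub_sub] at this
    · rintro p q (h | h)
      · have : T₁₂ p w = 0 := hK' p h
        simp [this]
      · exact hK q h p
  have hconv (j : ℕ) (m : ℤ) : conv T (fun k => y (n - j) (X j k)) m
      = ∑ i ∈ Finset.range M, y (n - j - i) (Z i j m) := by
    rw [conv, finsum_congr fun c => hhex j c _ (hXF j _), finsum_sum_comm]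
    · refine Finset.sum_congr rfl fun i _ => ?_
      rw [← map_finsum _ (hasFiniteSupport_conv_comp hT₁₃ (hT₁₂.hasse i) (hX j) m),
        ← conv_conv hT₁₃ (hT₁₂.hasse i) (hX j)]
    · intro i _
      exact (hasFiniteSupport_conv_comp hT₁₃ (hT₁₂.hasse i) (hX j) m).subset
        fun c hc hc' => hc (by simp only at hc'; simp [hc'])
  have hsum (m : ℤ) : ∑ j ∈ Finset.range M, ∑ i ∈ Finset.range M, y (n - j - i) (Z i j m)
      = ∑ k ∈ Finset.range M, y (n - k)
          (∑ ij ∈ Finset.HasAntidiagonal.antidiagonal k, Z ij.1 ij.2 m) := by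
    have h0 : ∀ k ∈ Finset.range M, y (n - k)
          (∑ ij ∈ Finset.HasAntidiagonal.antidiagonal k, Z ij.1 ij.2 m)
        = ∑ ij ∈ Finset.HasAntidiagonal.antidiagonal k, y (n - ij.2 - ij.1) (Z ij.1 ij.2 m) := by
      intro k _
      rw [map_sum]
      refine Finset.sum_congr rfl fun ij hij => ?_
      rw [← Finset.HasAntidiagonal.mem_antidiagonal.1 hij]
      congr 2
      push_cast
      ring
    rw [Finset.sum_congr rfl h0, Finset.sum_comm, ← Finset.sum_product', Finset.sum_sigma']
    symm
    refine Finset.sum_bij_ne_zero (fun x _ _ => x.2) ?_ ?_ ?_ ?_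
    · rintro ⟨k, i, j⟩ h _
      simp only [Finset.mem_sigma, Finset.mem_range, Finset.HasAntidiagonal.mem_antidiagonal,
        Finset.mem_product] at h ⊢
      omega
    · rintro ⟨k, i, j⟩ h _ ⟨k', i', j'⟩ h' _ he
      simp only [Finset.mem_sigma, Finset.HasAntidiagonal.mem_antidiagonal, Prod.mk.injEq] at h h' he
      obtain ⟨rfl, rfl⟩ := he
      obtain ⟨-, rfl⟩ := h
      obtain ⟨-, rfl⟩ := h'
      rfl
    · rintro ⟨i, j⟩ _ h
      refine ⟨⟨i + j, i, j⟩, ?_, h, rfl⟩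
      simp only [Finset.mem_sigma, Finset.mem_range, Finset.HasAntidiagonal.mem_antidiagonal, and_true]
      by_contra hij
      refine h ?_
      have := hy₃ _ (hZF i j m) (i + j) (by omega)
      rw [← this]
      congr 2
      push_cast
      ring
    · rintro ⟨k, i, j⟩ _ _
      rfl
  have hanti (k : ℕ) (m : ℤ) : ∑ ij ∈ Finset.HasAntidiagonal.antidiagonal k, Z ij.1 ij.2 m
      = if k = 0 then (if m = 0 then t else 0) else 0 := by
    simp only [Z]
    rw [← conv_sum hT₁₃ _ fun ij _ => (hT₁₂.hasse ij.1).conv (hX ij.2)]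
    simp only [X, sum_antidiagonal_conv_hasse_conv_hasse hT₁₂ hS₁₂ hTS₁₂ hsL]
    split_ifs with hk hm
    · rw [hTS₁₃, if_pos hm]
    · rw [hTS₁₃, if_neg hm]
    · simp [conv]
  have hyX : ∀ j ∈ Finset.range M, IsTensorLaurent fun k => y (n - j) (X j k) :=
    fun j _ => (hX j).map _
  have hTrhs : conv T (fun m => ∑ j ∈ Finset.range M, y (n - j) (X j m))
      = fun m => if m = 0 then y n t else 0 := by
    funext m
    rw [conv_sum hT _ hyX, Finset.sum_congr rfl fun j _ => hconv j m, hsum]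
    simp only [hanti]
    rw [Finset.sum_eq_single 0 (by intro k _ hk; simp [hk]) (by simp; omega)]
    split_ifs <;> simp_all
  have hL : IsTensorLaurent fun m => ∑ j ∈ Finset.range M, y (n - j) (X j m) :=
    IsTensorLaurent.sum _ hyX
  rw [hrhs]
  have := congrFun (conv_conv_of_inverse hS hT hST hL) m
  rw [hTrhs] at this
  rw [← this, conv, finsum_eq_single _ m]
  · simp
  · intro c hc
    rw [if_neg (by omega), map_zero]

end Convolution

section TwoFactors

variable {V : Type*} [AddCommGroup V] [Module ℂ V]

/-- The series `S²¹(-x)`. -/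
def S21neg (Sc : ℤ → (V ⊗[ℂ] V →ₗ[ℂ] V ⊗[ℂ] V)) (c : ℤ) : V ⊗[ℂ] V →ₗ[ℂ] V ⊗[ℂ] V :=
  ((-1 : ℂ) ^ c) • S21c Sc c

theorem S21neg_apply (Sc : ℤ → (V ⊗[ℂ] V →ₗ[ℂ] V ⊗[ℂ] V)) (c : ℤ) (t : V ⊗[ℂ] V) :
    S21neg Sc c t = ((-1 : ℂ) ^ c) •
      TensorProduct.comm ℂ V V (Sc c (TensorProduct.comm ℂ V V t)) := rfl

theorem IsTensorLaurentMap.S21neg {Sc : ℤ → (V ⊗[ℂ] V →ₗ[ℂ] V ⊗[ℂ] V)}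
    (h : IsTensorLaurentMap Sc) : IsTensorLaurentMap (S21neg Sc) := fun t =>
  ((h (TensorProduct.comm ℂ V V t)).map (TensorProduct.comm ℂ V V).toLinearMap).unit_mul
    fun c => (-1 : ℂ) ^ c

theorem Unitary.conv_S21neg {Sc : ℤ → (V ⊗[ℂ] V →ₗ[ℂ] V ⊗[ℂ] V)} (h : Unitary Sc)
    (t : V ⊗[ℂ] V) (n : ℤ) : conv Sc (fun d => S21neg Sc d t) n = if n = 0 then t else 0 := by
  rw [← h t n, conv]
  exact finsum_congr fun c => by simp only [S21neg, LinearMap.smul_apply, map_smul]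

theorem Unitary.S21neg_conv {Sc : ℤ → (V ⊗[ℂ] V →ₗ[ℂ] V ⊗[ℂ] V)} (h : Unitary Sc)
    (t : V ⊗[ℂ] V) (n : ℤ) : conv (S21neg Sc) (fun d => Sc d t) n = if n = 0 then t else 0 := by
  have h1 : conv (S21neg Sc) (fun d => Sc d t) n = ((-1 : ℂ) ^ n) • TensorProduct.comm ℂ V V
      (conv Sc (fun d => S21neg Sc d (TensorProduct.comm ℂ V V t)) n) := by
    simp only [conv]
    rw [← LinearEquiv.coe_addEquiv_apply, AddEquiv.map_finsum, smul_finsum]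
    refine finsum_congr fun c => ?_
    have hc : (-1 : ℂ) ^ c = (-1) ^ n * (-1) ^ (n - c) := by
      rw [← zpow_add₀ (by norm_num), show n + (n - c) = 2 * (n - c) + c by ring,
        zpow_add₀ (by norm_num), zpow_mul]
      norm_num
    simp [S21neg_apply, smul_smul, hc]
  rw [h1, h.conv_S21neg]
  split_ifs with hn <;> simp [hn]

end TwoFactors

section ThreeFactors

variable {V : Type*} [AddCommGroup V] [Module ℂ V]

theorem swap23_swap23 (t : (V ⊗[ℂ] V) ⊗[ℂ] V) : swap23 (swap23 t) = t := by
  have : (swap23 (V := V)).comp swap23 = LinearMap.id := TensorProduct.ext_threefold fun _ _ _ => rfl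
  exact LinearMap.congr_fun this t

theorem IsTensorLaurentMap.S12m {A : ℤ → (V ⊗[ℂ] V →ₗ[ℂ] V ⊗[ℂ] V)}
    (h : IsTensorLaurentMap A) : IsTensorLaurentMap (S12m A) := by
  intro w
  induction w using TensorProduct.induction_on with
  | zero => simpa using IsTensorLaurent.sum (W := (V ⊗[ℂ] V) ⊗[ℂ] V) (∅ : Finset ℕ) (a := 0) (by simp)
  | tmul t c => exact (h t).map ((TensorProduct.mk ℂ _ _).flip c)
  | add x y hx hy => simpa only [map_add] using hx.add hy

theorem IsTensorLaurentMap.S13m {A : ℤ → (V ⊗[ℂ] V →ₗ[ℂ] V ⊗[ℂ] V)}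
    (h : IsTensorLaurentMap A) : IsTensorLaurentMap (S13m A) := fun w =>
  (h.S12m (swap23 w)).map swap23

theorem conv_S12m {A B : ℤ → (V ⊗[ℂ] V →ₗ[ℂ] V ⊗[ℂ] V)} (hA : IsTensorLaurentMap A)
    (hB : IsTensorLaurentMap B) (h : ∀ t n, conv A (fun d => B d t) n = if n = 0 then t else 0)
    (t : (V ⊗[ℂ] V) ⊗[ℂ] V) (n : ℤ) :
    conv (S12m A) (fun d => S12m B d t) n = if n = 0 then t else 0 := by
  induction t using TensorProduct.induction_on with
  | zero => simp [conv]
  | tmul t c =>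
    have := congrArg ((TensorProduct.mk ℂ _ V).flip c) (h t n)
    rw [conv, map_finsum _ (hasFiniteSupport_conv hA (hB t) n)] at this
    refine this.trans ?_
    split_ifs <;> simp
  | add x y hx hy =>
    simp only [map_add]
    rw [conv_add hA.S12m (hB.S12m x) (hB.S12m y), hx, hy]
    split_ifs <;> simp

theorem conv_S13m {A B : ℤ → (V ⊗[ℂ] V →ₗ[ℂ] V ⊗[ℂ] V)} (hA : IsTensorLaurentMap A)
    (hB : IsTensorLaurentMap B) (h : ∀ t n, conv A (fun d => B d t) n = if n = 0 then t else 0)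
    (t : (V ⊗[ℂ] V) ⊗[ℂ] V) (n : ℤ) :
    conv (S13m A) (fun d => S13m B d t) n = if n = 0 then t else 0 := by
  have := congrArg swap23 (conv_S12m hA hB h (swap23 t) n)
  rw [conv, map_finsum _ (hasFiniteSupport_conv hA.S12m (hB.S12m _) n)] at this
  simp only [conv, S13m, LinearMap.comp_apply, swap23_swap23]
  refine this.trans ?_
  split_ifs <;> simp [swap23_swap23]

/-- The cyclic rotation `a ⊗ b ⊗ c ↦ b ⊗ c ⊗ a`. -/
def rotate : (V ⊗[ℂ] V) ⊗[ℂ] V ≃ₗ[ℂ] (V ⊗[ℂ] V) ⊗[ℂ] V :=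
  (TensorProduct.assoc ℂ V V V).trans (TensorProduct.comm ℂ V (V ⊗[ℂ] V))

theorem S13m_rotate (A : ℤ → (V ⊗[ℂ] V →ₗ[ℂ] V ⊗[ℂ] V)) (c : ℤ) (t : (V ⊗[ℂ] V) ⊗[ℂ] V) :
    S13m A c (rotate t) = rotate (S12m (S21c A) c t) := by
  have key (z : V ⊗[ℂ] V) (c : V) : swap23 (z ⊗ₜ[ℂ] c)
      = rotate ((TensorProduct.comm ℂ V V z) ⊗ₜ[ℂ] c) := by
    induction z using TensorProduct.induction_on with
    | zero => simp
    | tmul a b => rfl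
    | add x y hx hy => simp only [TensorProduct.add_tmul, map_add, hx, hy]
  have : (S13m A c).comp rotate.toLinearMap = rotate.toLinearMap.comp (S12m (S21c A) c) :=
    TensorProduct.ext_threefold fun x y z => key _ _
  exact LinearMap.congr_fun this t

theorem S23m_rotate (A : ℤ → (V ⊗[ℂ] V →ₗ[ℂ] V ⊗[ℂ] V)) (c : ℤ) (t : (V ⊗[ℂ] V) ⊗[ℂ] V) :
    S23m A c (rotate t) = rotate (S13m (S21c A) c t) := by
  have key (b : V) (z : V ⊗[ℂ] V) : (TensorProduct.assoc ℂ V V V).symm (b ⊗ₜ[ℂ] z)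
      = rotate (swap23 ((TensorProduct.comm ℂ V V z) ⊗ₜ[ℂ] b)) := by
    induction z using TensorProduct.induction_on with
    | zero => simp
    | tmul a b => rfl
    | add x y hx hy => simp only [TensorProduct.add_tmul, TensorProduct.tmul_add, map_add, hx, hy]
  have : (S23m A c).comp rotate.toLinearMap = rotate.toLinearMap.comp (S13m (S21c A) c) :=
    TensorProduct.ext_threefold fun x y z => key _ _
  exact LinearMap.congr_fun this t

variable (𝒱 : NLVA V)

/-- The coefficients of `1 ⊗ Y(x)` on `(V⊗V)⊗V`. -/
def idTensorY (n : ℤ) : (V ⊗[ℂ] V) ⊗[ℂ] V →ₗ[ℂ] V ⊗[ℂ] V :=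
  (LinearMap.lTensor V (TensorProduct.lift (𝒱.Yc n))).comp
    (TensorProduct.assoc ℂ V V V).toLinearMap

theorem isLaurent_idTensorY (t : (V ⊗[ℂ] V) ⊗[ℂ] V) : IsLaurent fun n => idTensorY 𝒱 n t := by
  induction t using TensorProduct.induction_on with
  | zero => exact ⟨0, fun n _ => by simp⟩
  | tmul z c =>
    induction z using TensorProduct.induction_on with
    | zero => exact ⟨0, fun n _ => by simp⟩
    | tmul a b =>
      obtain ⟨N, hN⟩ := 𝒱.trunc b c
      refine ⟨N, fun n hn => ?_⟩
      change a ⊗ₜ[ℂ] (𝒱.Y b c n) = 0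
      rw [hN n hn, TensorProduct.tmul_zero]
    | add x y hx hy =>
      obtain ⟨N, hN⟩ := hx
      obtain ⟨M, hM⟩ := hy
      refine ⟨min N M, fun n hn => ?_⟩
      simp only [TensorProduct.add_tmul, map_add] at hN hM ⊢
      rw [hN n (by omega), hM n (by omega), add_zero]
  | add x y hx hy =>
    obtain ⟨N, hN⟩ := hx
    obtain ⟨M, hM⟩ := hy
    refine ⟨min N M, fun n hn => ?_⟩
    simp only [map_add] at hN hM ⊢
    rw [hN n (by omega), hM n (by omega), add_zero]

theorem map_lift_rotate (n : ℤ) (t : (V ⊗[ℂ] V) ⊗[ℂ] V) :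
    TensorProduct.map (TensorProduct.lift (𝒱.Yc n)) LinearMap.id (rotate t)
      = TensorProduct.comm ℂ V V (idTensorY 𝒱 n t) := by
  have : (TensorProduct.map (TensorProduct.lift (𝒱.Yc n)) LinearMap.id).comp rotate.toLinearMap
      = (TensorProduct.comm ℂ V V).toLinearMap.comp (idTensorY 𝒱 n) :=
    TensorProduct.ext_threefold fun _ _ _ => rfl
  exact LinearMap.congr_fun this t

theorem S12m_S21neg (Sc : ℤ → (V ⊗[ℂ] V →ₗ[ℂ] V ⊗[ℂ] V)) (c : ℤ) :
    S12m (S21neg Sc) c = ((-1 : ℂ) ^ c) • S12m (S21c Sc) c :=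
  TensorProduct.map_smul_left _ _ _

theorem S13m_S21neg (Sc : ℤ → (V ⊗[ℂ] V →ₗ[ℂ] V ⊗[ℂ] V)) (c : ℤ) :
    S13m (S21neg Sc) c = ((-1 : ℂ) ^ c) • S13m (S21c Sc) c := by
  rw [S13m, S12m_S21neg, LinearMap.smul_comp, LinearMap.comp_smul, S13m]

variable {𝒱} in
/-- `S²¹(-x)(1⊗Y(z)) = (1⊗Y(z))S³¹(-x)S²¹(-x+z)`. -/
theorem HexY1.S21neg {Sc : ℤ → (V ⊗[ℂ] V →ₗ[ℂ] V ⊗[ℂ] V)} (h : HexY1 𝒱 Sc)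
    (t : (V ⊗[ℂ] V) ⊗[ℂ] V) (m n : ℤ) :
    _root_.S21neg Sc m (idTensorY 𝒱 n t) = ∑ᶠ (i : ℕ) (p : ℤ),
      ((-1 : ℂ) ^ i * ((zchoose p i : ℤ) : ℂ)) •
        idTensorY 𝒱 (n - i) (S13m (_root_.S21neg Sc) (m - p + i) (S12m (_root_.S21neg Sc) p t)) := by
  rw [S21neg_apply, ← map_lift_rotate, h, ← LinearEquiv.coe_addEquiv_apply, AddEquiv.map_finsum,
    smul_finsum]
  refine finsum_congr fun i => ?_
  rw [AddEquiv.map_finsum, smul_finsum]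
  refine finsum_congr fun p => ?_
  have hm : (-1 : ℂ) ^ m = (-1) ^ i * ((-1) ^ p * (-1) ^ (m - p + i)) := by
    rw [← zpow_natCast, ← zpow_add₀ (by norm_num), ← zpow_add₀ (by norm_num),
      show (i : ℤ) + (p + (m - p + i)) = 2 * i + m by ring, zpow_add₀ (by norm_num), zpow_mul]
    norm_num
  rw [S13m_rotate, S23m_rotate, map_lift_rotate, S12m_S21neg, S13m_S21neg, hm]
  simp only [LinearMap.smul_apply, map_smul, smul_smul, LinearEquiv.coe_addEquiv_apply,
    TensorProduct.comm_comm]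
  congr 1
  ring

end ThreeFactors

theorem QVA.hexY2 {V : Type*} [AddCommGroup V] [Module ℂ V] (Q : QVA V) : HexY2 Q.alg Q.Sc :=
  have hS : IsTensorLaurentMap Q.Sc := Q.laurent
  hexagon_of_inverse (y := idTensorY Q.alg) hS hS.S21neg hS.S12m hS.S21neg.S12m hS.S13m
    hS.S21neg.S13m (isLaurent_idTensorY Q.alg) Q.unitary.conv_S21neg
    (conv_S12m hS.S21neg hS Q.unitary.S21neg_conv) (conv_S13m hS.S21neg hS Q.unitary.S21neg_conv)
    Q.hex.S21neg

section Twisting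

variable {V : Type*} [AddCommGroup V] [Module ℂ V]

theorem QVA.Sc_tmul_one (Q : QVA V) (u : V) (n : ℤ) :
    Q.Sc n (u ⊗ₜ Q.alg.one) = if n = 0 then u ⊗ₜ Q.alg.one else 0 := by
  have h := Q.unitary.conv_S21neg (u ⊗ₜ Q.alg.one) n
  have hc (c : ℤ) : S21neg Q.Sc c (u ⊗ₜ Q.alg.one) = if c = 0 then u ⊗ₜ Q.alg.one else 0 := by
    rw [S21neg_apply, TensorProduct.comm_tmul, Q.vac]
    split_ifs with hc
    · simp [hc]
    · simp
  rw [conv, finsum_eq_single _ n (by intro c hcn; simp [hc, show n - c ≠ 0 by omega])] at h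
  simpa [hc] using h

theorem hex1RHS_comp_comm (𝒱 : NLVA V) (Sc : ℤ → (V ⊗[ℂ] V →ₗ[ℂ] V ⊗[ℂ] V)) (v u u' : V)
    (m n : ℤ) :
    hex1RHS 𝒱 (fun c => (Sc c).comp (TensorProduct.comm ℂ V V).toLinearMap) v u u' m n
      = ∑ᶠ (i : ℕ) (p : ℤ), ((zchoose p i : ℤ) : ℂ) •
          (TensorProduct.map (TensorProduct.lift (𝒱.Yc (n - i))) LinearMap.id)
            (S23m Sc (m - p + i) (S13m Sc p ((u ⊗ₜ u') ⊗ₜ v))) := by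
  refine finsum_congr fun i => ?_
  rw [← finsum_comp_equiv (Equiv.subLeft (m + i))]
  refine finsum_congr fun c => ?_
  rw [Equiv.subLeft_apply, show m - (m + i - c) + (i : ℤ) = c by ring,
    show m + (i : ℤ) - c = m - c + i by ring]
  have key (z : V ⊗[ℂ] V) : (LinearMap.lTensor V
      ((Sc (m - c + i)).comp (TensorProduct.comm ℂ V V).toLinearMap))
        ((TensorProduct.assoc ℂ V V V) (z ⊗ₜ u'))
      = LinearMap.lTensor V (Sc (m - c + i)) ((TensorProduct.assoc ℂ V V V) (swap23 (z ⊗ₜ u'))) := by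
    induction z using TensorProduct.induction_on with
    | zero => simp
    | tmul a b => rfl
    | add x y hx hy => simp only [TensorProduct.add_tmul, map_add, hx, hy]
  rw [key]
  rfl

theorem hex2RHS_comp_comm (𝒱 : NLVA V) (Sc : ℤ → (V ⊗[ℂ] V →ₗ[ℂ] V ⊗[ℂ] V)) (v v' u : V)
    (m n : ℤ) :
    hex2RHS 𝒱 (fun c => (Sc c).comp (TensorProduct.comm ℂ V V).toLinearMap) v v' u m n
      = ∑ᶠ (i : ℕ) (p : ℤ), ((-1 : ℂ) ^ i * ((zchoose p i : ℤ) : ℂ)) •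
          (LinearMap.lTensor V (TensorProduct.lift (𝒱.Yc (n - i))))
            ((TensorProduct.assoc ℂ V V V) (S12m Sc p (S13m Sc (m - p + i) ((u ⊗ₜ v) ⊗ₜ v')))) := by
  refine finsum_congr fun i => ?_
  rw [← finsum_comp_equiv (Equiv.subLeft (m + i))]
  refine finsum_congr fun c => ?_
  rw [Equiv.subLeft_apply, show m - (m + i - c) + (i : ℤ) = c by ring,
    show m + (i : ℤ) - c = m - c + i by ring]
  have key (z : V ⊗[ℂ] V) : (TensorProduct.map
      ((Sc c).comp (TensorProduct.comm ℂ V V).toLinearMap) LinearMap.id)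
        ((TensorProduct.assoc ℂ V V V).symm (v ⊗ₜ z))
      = S12m Sc c (swap23 (z ⊗ₜ v)) := by
    induction z using TensorProduct.induction_on with
    | zero => simp
    | tmul a b => rfl
    | add x y hx hy => simp only [TensorProduct.add_tmul, TensorProduct.tmul_add, map_add, hx, hy]
  rw [key]
  rfl

/-- The twisting operator `R(x) = S(x)σ`. -/
def QVA.twistingOp (Q : QVA V) : TwistingOp Q.alg Q.alg where
  Rc n := (Q.Sc n).comp (TensorProduct.comm ℂ V V).toLinearMap
  laurent t := Q.laurent (TensorProduct.comm ℂ V V t)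
  vac_right v n := Q.vac v n
  vac_left u n := Q.Sc_tmul_one u n
  hex1 v u u' m n := by
    rw [hex1RHS_comp_comm, ← Q.hex]
    rfl
  hex2 v v' u m n := by
    rw [hex2RHS_comp_comm, ← Q.hexY2]
    rfl

theorem QVA.isInvPair_twistingOp (Q : QVA V) :
    IsInvPair Q.twistingOp.Rc
      (fun n => (TensorProduct.comm ℂ V V).toLinearMap.comp (S21neg Q.Sc n)) := by
  have hS : IsTensorLaurentMap Q.Sc := Q.laurent
  refine ⟨fun t => (hS.S21neg t).map (TensorProduct.comm ℂ V V).toLinearMap, fun t n => ?_, fun t n => ?_⟩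
  · have h := congrArg (TensorProduct.comm ℂ V V)
      (Q.unitary.S21neg_conv (TensorProduct.comm ℂ V V t) n)
    rw [conv, ← LinearEquiv.coe_addEquiv_apply, AddEquiv.map_finsum] at h
    refine h.trans ?_
    split_ifs <;> simp
  · rw [← Q.unitary.conv_S21neg t n]
    exact finsum_congr fun c => by simp [QVA.twistingOp]

end Twisting

/-- For a quantum vertex algebra `(V,𝒮)`, the map `R(x) = 𝒮(x)σ` is an
invertible twisting operator for the ordered pair `(V,V)` (Lemma 3.7). -/
theorem statement_12 {V : Type*} [AddCommGroup V] [Module ℂ V] (Q : QVA V) :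
    ∃ Rop : TwistingOp Q.alg Q.alg,
      (∀ n : ℤ, Rop.Rc n = (Q.Sc n).comp (TensorProduct.comm ℂ V V).toLinearMap) ∧
      ∃ Sc' : ℤ → (V ⊗[ℂ] V →ₗ[ℂ] V ⊗[ℂ] V), IsInvPair Rop.Rc Sc' :=
  ⟨Q.twistingOp, fun _ => rfl, _, Q.isInvPair_twistingOp⟩
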